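/- arXiv:math/0611698 — 2 statements merged into one kernel-verified Lean document; each statement's English description precedes it below -/
import Mathlib

section
/- A Dyck path P satisfies F(P) = P if and only if P contains no occurrence of the word DUDD and no contiguous substring of the form U U Q D D with Q a nonempty Dyck path. -/
namespace Paper

/-- A step of a lattice path: `true` is an upstep `U`, `false` is a downstep `D`. -/
abbrev Step := Bool

def U : Step := true
def D : Step := false

/-- `p` is a Dyck path: equally many `U`s and `D`s, and every prefix has at
least as many `U`s as `D`s. -/
def IsDyck (p : List Step) : Prop :=
  p.count U = p.count D ∧ ∀ n : ℕ, (p.take n).count D ≤ (p.take n).count U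

/-- `p` is a primitive Dyck path: it is a nonempty Dyck path and every proper
nonempty prefix has strictly more `U`s than `D`s. -/
def IsPrim (p : List Step) : Prop :=
  IsDyck p ∧ p ≠ [] ∧
    ∀ n : ℕ, 0 < n → n < p.length → (p.take n).count D < (p.take n).count U

/-- `U^i`. -/
def Us (i : ℕ) : List Step := List.replicate i U

/-- `D^i`. -/
def Ds (i : ℕ) : List Step := List.replicate i D

/-- `(UD)^i`. -/
def UDs (i : ℕ) : List Step := (List.replicate i [U, D]).flatten

/-- `p` ends with `DD`. -/
def EndsDD (p : List Step) : Prop := ∃ q, p = q ++ [D, D]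

/-- `FSpec F` says that `F` satisfies the defining recursion of the bijection `F`
on Dyck paths: `F ε = ε`; `F` acts componentwise (equivalently, it distributes
over the concatenation of a primitive Dyck path and a nonempty Dyck path); and on
a primitive path `U Q (UD)^i D` (with `Q` a Dyck path that is empty or ends `DD`)
it is given by the two displayed cases according as `Q` is primitive or not. -/
def FSpec (F : List Step → List Step) : Prop :=
  F [] = [] ∧
  (∀ p q, IsPrim p → IsDyck q → q ≠ [] → F (p ++ q) = F p ++ F q) ∧
  (∀ (i : ℕ) (R : List Step), IsDyck R → IsPrim ([U] ++ R ++ [D]) →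
      EndsDD ([U] ++ R ++ [D]) →
      F ([U] ++ ([U] ++ R ++ [D]) ++ UDs i ++ [D]) = Us i ++ F R ++ [U, D] ++ Ds i) ∧
  (∀ (i : ℕ) (Q : List Step), IsDyck Q → ¬ IsPrim Q → (Q = [] ∨ EndsDD Q) →
      F ([U] ++ Q ++ UDs i ++ [D]) = Us (i + 1) ++ F Q ++ Ds (i + 1))

theorem IsDyck.count_prefix_le {p a b : List Step} (h : IsDyck p) (e : p = a ++ b) :
    a.count D ≤ a.count U := by
  have := h.2 a.length
  rwa [e, List.take_left] at this

theorem IsDyck.of_count_le {p : List Step} (h : p.count U = p.count D)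
    (h' : ∀ a b, p = a ++ b → a.count D ≤ a.count U) : IsDyck p :=
  ⟨h, fun n => h' _ _ (List.take_append_drop n p).symm⟩

theorem IsPrim.count_prefix_lt {p a b : List Step} (h : IsPrim p) (e : p = a ++ b)
    (ha : a ≠ []) (hb : b ≠ []) : a.count D < a.count U := by
  have := h.2.2 a.length (List.length_pos_iff.2 ha)
    (by rw [e, List.length_append]; have := List.length_pos_iff.2 hb; omega)
  rwa [e, List.take_left] at this

theorem IsPrim.of_count_lt {p : List Step} (h : p.count U = p.count D) (hp : p ≠ [])
    (h' : ∀ a b, p = a ++ b → a ≠ [] → b ≠ [] → a.count D < a.count U) : IsPrim p := by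
  refine ⟨IsDyck.of_count_le h fun a b e => ?_, hp, fun n h0 hn => ?_⟩
  · rcases eq_or_ne a [] with rfl | ha
    · simp
    rcases eq_or_ne b [] with rfl | hb
    · rw [List.append_nil] at e
      rw [← e, h]
    · exact (h' a b e ha hb).le
  · refine h' _ _ (List.take_append_drop n p).symm ?_ ?_
    · simp [hp]; omega
    · simpa using hn

theorem isDyck_nil : IsDyck [] := ⟨rfl, fun n => by simp⟩

theorem IsDyck.left_of_append {p q : List Step} (h : IsDyck (p ++ q))
    (hp : p.count U = p.count D) : IsDyck p :=
  IsDyck.of_count_le hp fun a b e => h.count_prefix_le (b := b ++ q) (by simp [e])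

theorem IsDyck.right_of_append {p q : List Step} (h : IsDyck (p ++ q))
    (hp : p.count U = p.count D) : IsDyck q := by
  refine IsDyck.of_count_le ?_ fun a b e => ?_
  · have := h.1
    simp only [List.count_append] at this
    omega
  · have := h.count_prefix_le (a := p ++ a) (b := b) (by simp [e])
    simp only [List.count_append] at this
    omega

theorem IsDyck.count_suffix_le {p a b : List Step} (h : IsDyck p) (e : p = a ++ b) :
    b.count U ≤ b.count D := by
  have h1 := h.1
  have h2 := h.count_prefix_le e
  subst e
  simp only [List.count_append] at h1
  omega

theorem IsDyck.eq_U_cons {p : List Step} (h : IsDyck p) (hp : p ≠ []) :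
    ∃ q, p = [U] ++ q := by
  rcases p with _ | ⟨_ | _, q⟩
  · exact absurd rfl hp
  · have := h.count_prefix_le (a := [D]) (b := q) rfl
    simp [U, D] at this
  · exact ⟨q, rfl⟩

theorem IsDyck.eq_append_D {p : List Step} (h : IsDyck p) (hp : p ≠ []) :
    ∃ q, p = q ++ [D] := by
  obtain ⟨q, x, rfl⟩ := (List.eq_nil_or_concat p).resolve_left hp
  rcases x with _ | _
  · exact ⟨q, by simp [D]⟩
  · have := h.count_suffix_le (a := q) (b := [U]) (by simp [U])
    simp [U, D] at this

theorem IsDyck.isPrim_wrap {Q : List Step} (h : IsDyck Q) : IsPrim ([U] ++ Q ++ [D]) := by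
  refine IsPrim.of_count_lt ?_ (by simp) fun a b e ha hb => ?_
  · have := h.1
    simp only [List.count_append]
    simp [U, D] at this ⊢
    omega
  · obtain ⟨b, x, rfl⟩ := (List.eq_nil_or_concat b).resolve_left hb
    rcases a with _ | ⟨y, a⟩
    · exact absurd rfl ha
    rw [List.concat_eq_append, ← List.append_assoc] at e
    obtain ⟨e, -⟩ := List.append_inj' e rfl
    obtain ⟨rfl, eQ⟩ := List.cons.inj e
    have := h.count_prefix_le eQ
    simp [U, D] at this ⊢
    omega

theorem IsPrim.exists_eq_wrap {p : List Step} (h : IsPrim p) :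
    ∃ Q, IsDyck Q ∧ p = [U] ++ Q ++ [D] := by
  obtain ⟨q, rfl⟩ := h.1.eq_U_cons h.2.1
  rcases List.eq_nil_or_concat q with rfl | ⟨Q, x, rfl⟩
  · have := h.1.1
    simp [U, D] at this
  have hx : x = D := by
    obtain ⟨r, hr⟩ := h.1.eq_append_D h.2.1
    rw [List.concat_eq_append, ← List.append_assoc] at hr
    simpa using (List.append_inj' hr rfl).2
  subst hx
  refine ⟨Q, IsDyck.of_count_le ?_ fun a b e => ?_, by simp⟩
  · have := h.1.1
    simp [U, D] at this ⊢
    omega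
  · have := h.count_prefix_lt (a := [U] ++ a) (b := b ++ [D]) (by simp [e]) (by simp) (by simp)
    simp [U, D] at this ⊢
    omega

theorem IsDyck.exists_prim_append {p : List Step} (h : IsDyck p) (hp : p ≠ []) :
    ∃ q r, IsPrim q ∧ IsDyck r ∧ p = q ++ r := by
  classical
  have hex : ∃ n, 0 < n ∧ (p.take n).count U = (p.take n).count D :=
    ⟨p.length, List.length_pos_iff.2 hp, by simpa using h.1⟩
  obtain ⟨h0, hn⟩ := Nat.find_spec hex
  set n := Nat.find hex
  have e := (List.take_append_drop n p).symm
  have hd : IsDyck (p.take n ++ p.drop n) := e ▸ h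
  refine ⟨p.take n, p.drop n, ⟨hd.left_of_append hn, ?_, fun m hm hml => ?_⟩,
    hd.right_of_append hn, e⟩
  · simp [hp]; omega
  · have hmn : m < n := by simp at hml; omega
    have h1 := Nat.find_min hex hmn
    rw [List.take_take, min_eq_left hmn.le]
    have h2 := h.2 m
    have h3 : (p.take m).count U ≠ (p.take m).count D := fun h => h1 ⟨hm, h⟩
    omega

theorem UDs_succ (i : ℕ) : UDs (i + 1) = UDs i ++ [U, D] := by
  simp [UDs, List.replicate_succ']

@[simp] theorem length_UDs (i : ℕ) : (UDs i).length = 2 * i := by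
  simp [UDs]; omega

theorem IsDyck.exists_eq_append_UDs {p : List Step} (h : IsDyck p) :
    ∃ Q i, IsDyck Q ∧ (Q = [] ∨ EndsDD Q) ∧ p = Q ++ UDs i := by
  rcases eq_or_ne p [] with rfl | hp
  · exact ⟨[], 0, isDyck_nil, Or.inl rfl, rfl⟩
  obtain ⟨q, rfl⟩ := h.eq_append_D hp
  rcases List.eq_nil_or_concat q with rfl | ⟨r, x, rfl⟩
  · have := h.1
    simp [U, D] at this
  rcases x with _ | _
  · exact ⟨_, 0, h, Or.inr ⟨r, by simp [D]⟩, by simp [UDs]⟩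
  · have e : r.concat true ++ [D] = r ++ [U, D] := by simp [U]
    rw [e] at h ⊢
    have hr : IsDyck r := h.left_of_append (by
      have := h.1
      simp [U, D] at this ⊢
      omega)
    obtain ⟨Q, i, hQ, hQ', rfl⟩ := hr.exists_eq_append_UDs
    exact ⟨Q, i + 1, hQ, hQ', by simp [UDs_succ]⟩
termination_by p.length
decreasing_by simp_all

/-- Induction along the recursion defining `F`. -/
theorem IsDyck.induction {motive : List Step → Prop} (nil : motive [])
    (append : ∀ p q, IsPrim p → IsDyck q → q ≠ [] → motive p → motive q → motive (p ++ q))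
    (wrap_prim : ∀ (i : ℕ) (R : List Step), IsDyck R → IsPrim ([U] ++ R ++ [D]) →
      EndsDD ([U] ++ R ++ [D]) → motive R →
      motive ([U] ++ ([U] ++ R ++ [D]) ++ UDs i ++ [D]))
    (wrap : ∀ (i : ℕ) (Q : List Step), IsDyck Q → ¬ IsPrim Q → (Q = [] ∨ EndsDD Q) →
      motive Q → motive ([U] ++ Q ++ UDs i ++ [D]))
    {p : List Step} (hp : IsDyck p) : motive p := by
  induction hl : p.length using Nat.strong_induction_on generalizing p with
  | _ l ih =>
  subst hl
  rcases eq_or_ne p [] with rfl | hne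
  · exact nil
  obtain ⟨q, r, hq, hr, rfl⟩ := hp.exists_prim_append hne
  rcases eq_or_ne r [] with rfl | hrne
  · obtain ⟨S, hS, rfl⟩ := hq.exists_eq_wrap
    obtain ⟨Q, i, hQ, hQ', rfl⟩ := hS.exists_eq_append_UDs
    by_cases hprim : IsPrim Q
    · obtain ⟨R, hR, rfl⟩ := hprim.exists_eq_wrap
      have := wrap_prim i R hR hprim (hQ'.resolve_left (by simp))
        (ih _ (by simp; omega) hR rfl)
      simpa using this
    · have := wrap i Q hQ hprim hQ' (ih _ (by simp) hQ rfl)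
      simpa using this
  · have h1 := List.length_pos_iff.2 hrne
    have h2 := List.length_pos_iff.2 hq.2.1
    exact append q r hq hr hrne (ih _ (by simp; omega) hq.1 rfl)
      (ih _ (by simp; omega) hr rfl)

theorem FSpec.length_le {F : List Step → List Step} (hF : FSpec F) {P : List Step}
    (hP : IsDyck P) : (F P).length ≤ P.length := by
  obtain ⟨h0, h1, h2, h3⟩ := hF
  refine IsDyck.induction (motive := fun P => (F P).length ≤ P.length)
    ?_ ?_ ?_ ?_ hP
  · simp [h0]
  · intro p q hp hq hne ihp ihq
    rw [h1 p q hp hq hne]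
    simp only [List.length_append]
    omega
  · intro i R hR hp hd ih
    rw [h2 i R hR hp hd]
    simp [Us, Ds]
    omega
  · intro i Q hQ hp hd ih
    rw [h3 i Q hQ hp hd]
    simp [Us, Ds]
    omega

theorem FSpec.not_ends_U {F : List Step → List Step} (hF : FSpec F) {P : List Step}
    (hP : IsDyck P) : ∀ s, F P ≠ s ++ [U] := by
  obtain ⟨h0, h1, h2, h3⟩ := hF
  refine IsDyck.induction (motive := fun P => ∀ s, F P ≠ s ++ [U])
    ?_ ?_ ?_ ?_ hP
  · simp [h0]
  · intro p q hp hq hne ihp ihq s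
    rw [h1 p q hp hq hne]
    rcases List.eq_nil_or_concat (F q) with h | ⟨t, x, h⟩
    · simpa [h] using ihp s
    · intro e
      rw [h, List.concat_eq_append, ← List.append_assoc] at e
      have hx := (List.append_inj' e rfl).2
      exact ihq t (by rw [h, List.concat_eq_append, hx])
  · intro i R hR hp hd ih s e
    rw [h2 i R hR hp hd] at e
    have := congrArg List.getLast? e
    rcases i with _ | i
    · simp [Ds, U, D] at this
    · rw [Ds, List.replicate_succ', ← List.append_assoc, List.getLast?_concat,
        List.getLast?_concat] at this
      simp [U, D] at this
  · intro i Q hQ hp hd ih s e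
    rw [h3 i Q hQ hp hd] at e
    have := congrArg List.getLast? e
    simp [Ds, U, D, List.replicate_succ'] at this

/-- The words that a fixed point of `F` avoids: `DUDD`, and `UUQDD` with `Q` a nonempty
Dyck path. -/
def IsForbidden (w : List Step) : Prop :=
  w = [D, U, D, D] ∨ ∃ Q, Q ≠ [] ∧ IsDyck Q ∧ w = [U, U] ++ Q ++ [D, D]

/-- `P` has no forbidden contiguous substring. -/
def Avoids (P : List Step) : Prop := ∀ w, IsForbidden w → ¬ w <:+: P

theorem avoids_iff (P : List Step) : Avoids P ↔
    (¬ [D, U, D, D] <:+: P) ∧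
      ¬ ∃ A Q B : List Step, Q ≠ [] ∧ IsDyck Q ∧
          P = A ++ [U, U] ++ Q ++ [D, D] ++ B := by
  constructor
  · intro h
    refine ⟨h _ (Or.inl rfl), ?_⟩
    rintro ⟨A, Q, B, hne, hQ, rfl⟩
    exact h _ (Or.inr ⟨Q, hne, hQ, rfl⟩) ⟨A, B, by simp⟩
  · rintro ⟨h1, h2⟩ w (rfl | ⟨Q, hne, hQ, rfl⟩) hw
    · exact h1 hw
    · obtain ⟨A, B, e⟩ := hw
      exact h2 ⟨A, Q, B, hne, hQ, by simp [← e]⟩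

theorem isPrim_UU_append_DD {Q : List Step} (hQ : IsDyck Q) :
    IsPrim ([U, U] ++ Q ++ [D, D]) := by
  simpa using hQ.isPrim_wrap.1.isPrim_wrap

theorem IsForbidden.split {X Y : List Step} (h : IsForbidden (X ++ Y)) (hX : X ≠ [])
    (hY : Y ≠ []) (hX' : X.count U ≤ X.count D) (hY' : Y.count D ≤ Y.count U) : False := by
  rcases h with h | ⟨Q, -, hQ, h⟩
  · rcases X with _ | ⟨x, _ | ⟨y, _ | ⟨z, _ | ⟨t, X⟩⟩⟩⟩ <;> simp_all [U, D]
  · have := (isPrim_UU_append_DD hQ).count_prefix_lt h.symm hX hY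
    omega

theorem IsForbidden.infix_append {w p q : List Step} (hw : IsForbidden w) (hp : IsDyck p)
    (hq : IsDyck q) (h : w <:+: p ++ q) : w <:+: p ∨ w <:+: q := by
  obtain ⟨A, B, e⟩ := h
  rcases List.append_eq_append_iff.1 e with ⟨C, rfl, -⟩ | ⟨Y, e1, rfl⟩
  · exact Or.inl ⟨A, C, rfl⟩
  rcases List.append_eq_append_iff.1 e1 with ⟨X, rfl, rfl⟩ | ⟨Z, rfl, rfl⟩
  · rcases eq_or_ne X [] with rfl | hX
    · exact Or.inr ⟨[], B, by simp⟩
    rcases eq_or_ne Y [] with rfl | hY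
    · exact Or.inl ⟨A, [], by simp⟩
    exact (hw.split hX hY (hp.count_suffix_le rfl) (hq.count_prefix_le rfl)).elim
  · exact Or.inr ⟨Z, B, by simp⟩

theorem avoids_append {p q : List Step} (hp : IsDyck p) (hq : IsDyck q) :
    Avoids (p ++ q) ↔ Avoids p ∧ Avoids q := by
  constructor
  · intro h
    exact ⟨fun w hw h' => h w hw (h'.trans (List.prefix_append p q).isInfix),
      fun w hw h' => h w hw (h'.trans (List.suffix_append p q).isInfix)⟩
  · rintro ⟨h1, h2⟩ w hw h
    exact (hw.infix_append hp hq h).elim (h1 w hw) (h2 w hw)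

theorem IsForbidden.infix_of_wrap {w Q : List Step} (hw : IsForbidden w) (hQ : IsDyck Q)
    (hprim : ¬ IsPrim Q) (hd : EndsDD Q) (h : w <:+: [U] ++ Q ++ [D]) : w <:+: Q := by
  obtain ⟨A, B, e⟩ := h
  have hP := hQ.isPrim_wrap
  have key : ∀ R, R ≠ [] → IsDyck R → w = [U, U] ++ R ++ [D, D] → A = [] ∨ B = [] → False := by
    rintro R - hR rfl hAB
    have hb := (isPrim_UU_append_DD hR).1.1
    have hA : A = [] := by
      by_contra hA
      have hB := hAB.resolve_left hA
      subst hB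
      have h1 := hP.count_prefix_lt (a := A) (b := [U, U] ++ R ++ [D, D])
        (by rw [← e, List.append_nil]) hA (by simp)
      have h2 := hP.1.1
      rw [← e, List.append_nil, List.count_append, List.count_append (l₁ := A)] at h2
      omega
    subst hA
    have hB : B = [] := by
      by_contra hB
      have h1 := hP.count_prefix_lt (a := [U, U] ++ R ++ [D, D]) (b := B)
        (by rw [← e, List.nil_append]) (by simp) hB
      omega
    subst hB
    apply hprim
    have e' : ([U] ++ Q) ++ [D] = ([U] ++ ([U] ++ R ++ [D])) ++ [D] := by rw [← e]; simp
    have : Q = [U] ++ R ++ [D] := List.append_cancel_left (List.append_inj' e' rfl).1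
    exact this ▸ hR.isPrim_wrap
  rcases A with _ | ⟨x, A⟩
  · rcases hw with rfl | ⟨R, hne, hR, hw⟩
    · simp [U, D] at e
    · exact (key R hne hR hw (Or.inl rfl)).elim
  rcases List.eq_nil_or_concat B with rfl | ⟨B, y, rfl⟩
  · rcases hw with rfl | ⟨R, hne, hR, hw⟩
    · obtain ⟨s, rfl⟩ := hd
      have e' : (x :: A ++ [D]) ++ [U, D, D] = ([U] ++ s) ++ [D, D, D] := by simpa using e
      have := (List.append_inj' e' rfl).2
      simp [U, D] at this
    · exact (key R hne hR hw (Or.inr rfl)).elim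
  · have e' : (x :: (A ++ w ++ B)) ++ [y] = (U :: Q) ++ [D] := by simpa using e
    have := (List.append_inj' e' rfl).1
    exact ⟨A, B, (List.cons.inj this).2⟩

theorem avoids_wrap {Q : List Step} (hQ : IsDyck Q) (hprim : ¬ IsPrim Q) (hd : EndsDD Q) :
    Avoids ([U] ++ Q ++ [D]) ↔ Avoids Q :=
  ⟨fun h w hw h' => h w hw (h'.trans ⟨[U], [D], rfl⟩),
    fun h w hw h' => h w hw (hw.infix_of_wrap hQ hprim hd h')⟩

theorem not_avoids_DUDD (A : List Step) : ¬ Avoids (A ++ [D, U, D, D]) :=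
  fun h => h _ (Or.inl rfl) (List.suffix_append _ _).isInfix

theorem avoids_of_length_lt {P : List Step} (h : P.length < 4 ∨ P = [U, U, D, D]) :
    Avoids P := by
  rintro w (rfl | ⟨Q, hne, hQ, rfl⟩) hw
  · rcases h with h | rfl
    · have := hw.length_le
      simp at this
      omega
    · simpa [U, D] using hw.eq_of_length rfl
  · have h1 := hw.length_le
    have h2 := List.length_pos_iff.2 hne
    rcases h with h | rfl <;> simp at h1 <;> omega

theorem FSpec.eq_self_iff_avoids {F : List Step → List Step} (hF : FSpec F) {P : List Step}
    (hP : IsDyck P) : F P = P ↔ Avoids P := by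
  have hlen {P} := hF.length_le (P := P)
  have hlast {P} := hF.not_ends_U (P := P)
  obtain ⟨h0, h1, h2, h3⟩ := hF
  refine IsDyck.induction (motive := fun P => F P = P ↔ Avoids P)
    ?_ ?_ ?_ ?_ hP
  · simp [h0, avoids_of_length_lt]
  · intro p q hp hq hne ihp ihq
    rw [h1 p q hp hq hne, avoids_append hp.1 hq, ← ihp, ← ihq]
    constructor
    · intro e
      have hl := congrArg List.length e
      have hlp := hlen hp.1
      have hlq := hlen hq
      simp only [List.length_append] at hl
      exact List.append_inj e (by omega)
    · rintro ⟨e1, e2⟩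
      rw [e1, e2]
  · intro i R hR hp hd ih
    rw [h2 i R hR hp hd]
    refine iff_of_false (fun e => ?_) ?_
    · have hl := congrArg List.length e
      have := hlen hR
      simp [Us, Ds] at hl
      omega
    · rcases i with _ | i
      · intro h
        refine h ([U, U] ++ R ++ [D, D]) (Or.inr ⟨R, ?_, hR, rfl⟩) ⟨[], [], by simp [UDs]⟩
        rintro rfl
        obtain ⟨s, hs⟩ := hd
        have := (List.append_inj' (s₁ := []) (t₁ := [U, D]) hs rfl).2
        simp [U, D] at this
      · rcases i with _ | i
        · simpa [UDs] using not_avoids_DUDD ([U, U] ++ R)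
        · have := not_avoids_DUDD ([U, U] ++ R ++ [D] ++ UDs i ++ [U])
          simpa [UDs_succ] using this
  · intro i Q hQ hp hd ih
    rw [h3 i Q hQ hp hd]
    rcases i with _ | _ | i
    · rcases hd with rfl | hd
      · simp [Us, Ds, UDs, h0, avoids_of_length_lt]
      · have := avoids_wrap hQ hp hd
        simp only [Us, Ds, UDs, List.replicate_zero, List.flatten_nil, List.append_nil, this,
          ← ih, List.replicate_one, zero_add]
        simp
    · rcases hd with rfl | ⟨s, rfl⟩
      · simp [Us, Ds, UDs, h0, avoids_of_length_lt]
      · refine iff_of_false (fun e => ?_) ?_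
        · have e' : (U :: F (s ++ [D, D])) ++ [D, D] = (s ++ [D, D, U]) ++ [D, D] := by
            simpa [Us, Ds, UDs, List.replicate_succ] using e
          have e2 := (List.append_inj' e' rfl).1
          rcases List.eq_nil_or_concat (F (s ++ [D, D])) with h | ⟨t, x, h⟩
          · rw [h] at e2
            have := congrArg List.length e2
            simp at this
          · rw [h, List.concat_eq_append] at e2
            have e3 : (U :: t) ++ [x] = (s ++ [D, D]) ++ [U] := by simpa using e2
            have hx := (List.append_inj' e3 rfl).2
            exact hlast hQ t (by rw [h, List.concat_eq_append, hx])
        · simpa [UDs] using not_avoids_DUDD ([U] ++ s ++ [D])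
    · refine iff_of_false (fun e => ?_) ?_
      · have e' : (Us (i + 1 + 1 + 1) ++ F Q ++ Ds i) ++ [D, D, D] =
            ([U] ++ Q ++ UDs (i + 1)) ++ [U, D, D] := by
          simpa [Ds, UDs_succ, List.replicate_succ'] using e
        have := (List.append_inj' e' rfl).2
        simp [U, D] at this
      · have := not_avoids_DUDD ([U] ++ Q ++ UDs i ++ [U])
        simpa [UDs_succ] using this

/-- A Dyck path `P` is a fixed point of `F` iff `P` contains
no occurrence of `DUDD` and no contiguous substring `U U Q D D` with `Q` a
nonempty Dyck path. -/
theorem stmt_12 (F : List Step → List Step) (hF : FSpec F)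
    (P : List Step) (hP : IsDyck P) :
    F P = P ↔
      (¬ [D, U, D, D] <:+: P) ∧
      ¬ ∃ A Q B : List Step, Q ≠ [] ∧ IsDyck Q ∧
          P = A ++ [U, U] ++ Q ++ [D, D] ++ B := by
  rw [hF.eq_self_iff_avoids hP, avoids_iff]

end Paper
end

section
/- For every n ≥ 3, if N denotes the number of Dyck n-paths that end with DD and contain an occurrence of DUU whose downstep ends at height 0, then (n − 1) · N = 2 · C(2n − 2, n − 3). (Equivalently, N equals the generalized Catalan number C^{(4)}_{n−3} = (4/(2(n−3)+4)) · C(2(n−3)+4, n−3).) -/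
namespace Paper

/-- `p` contains an occurrence of `DUU` whose downstep ends at height 0. -/
def GroundDUU (p : List Step) : Prop :=
  ∃ j : ℕ, (p.drop j).take 3 = [D, U, U] ∧
    (p.take (j + 1)).count U = (p.take (j + 1)).count D

/-- The Dyck paths of size `n`. -/
def dyckPaths (n : ℕ) : Set (List Step) := {p | IsDyck p ∧ p.count U = n}

/-- Upsteps and downsteps as the steps of a `DyckWord`. -/
def stepEquiv : Step ≃ DyckStep where
  toFun b := if b = U then DyckStep.U else DyckStep.D
  invFun s := if s = DyckStep.U then U else D
  left_inv b := by cases b <;> rfl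
  right_inv s := by cases s <;> rfl

lemma count_map_stepEquiv_U (l : List Step) :
    (l.map stepEquiv).count DyckStep.U = l.count U :=
  List.count_map_of_injective l stepEquiv stepEquiv.injective U

lemma count_map_stepEquiv_D (l : List Step) :
    (l.map stepEquiv).count DyckStep.D = l.count D :=
  List.count_map_of_injective l stepEquiv stepEquiv.injective D

lemma count_map_stepEquiv_symm_U (l : List DyckStep) :
    (l.map stepEquiv.symm).count U = l.count DyckStep.U :=
  List.count_map_of_injective l stepEquiv.symm stepEquiv.symm.injective DyckStep.U

lemma count_map_stepEquiv_symm_D (l : List DyckStep) :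
    (l.map stepEquiv.symm).count D = l.count DyckStep.D :=
  List.count_map_of_injective l stepEquiv.symm stepEquiv.symm.injective DyckStep.D

/-- Dyck paths of size `n` are the Dyck words of semilength `n`. -/
def dyckPathsEquiv (n : ℕ) : dyckPaths n ≃ {p : DyckWord // p.semilength = n} where
  toFun p := ⟨⟨p.1.map stepEquiv,
      by rw [count_map_stepEquiv_U, count_map_stepEquiv_D]; exact p.2.1.1,
      fun i => by
        rw [← List.map_take, count_map_stepEquiv_U, count_map_stepEquiv_D]; exact p.2.1.2 i⟩,
    (count_map_stepEquiv_U p.1).trans p.2.2⟩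
  invFun w := ⟨w.1.toList.map stepEquiv.symm,
    ⟨by rw [count_map_stepEquiv_symm_U, count_map_stepEquiv_symm_D]
        exact w.1.count_U_eq_count_D,
      fun i => by
        rw [← List.map_take, count_map_stepEquiv_symm_U, count_map_stepEquiv_symm_D]
        exact w.1.count_D_le_count_U i⟩,
    (count_map_stepEquiv_symm_U _).trans w.2⟩
  left_inv p := by ext1; simp
  right_inv w := by ext1; ext1; simp

lemma ncard_dyckPaths (n : ℕ) : (dyckPaths n).ncard = catalan n := by
  rw [← DyckWord.card_dyckWord_semilength_eq_catalan, ← Nat.card_eq_fintype_card,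
    ← Nat.card_coe_set_eq]
  exact Nat.card_congr (dyckPathsEquiv n)

lemma finite_dyckPaths (n : ℕ) : (dyckPaths n).Finite :=
  Set.finite_coe_iff.mp (Finite.of_equiv _ (dyckPathsEquiv n).symm)

lemma IsDyck.append {p q : List Step} (hp : IsDyck p) (hq : IsDyck q) : IsDyck (p ++ q) := by
  refine ⟨by simp [List.count_append, hp.1, hq.1], fun i => ?_⟩
  rw [List.take_append, List.count_append, List.count_append]
  exact add_le_add (hp.2 _) (hq.2 _)

lemma isDyck_UD : IsDyck [U, D] := by
  refine ⟨by decide, fun i => ?_⟩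
  rcases i with _ | _ | i <;> simp [U, D]

lemma count_D_take_append_D_le (q : List Step) (i : ℕ) :
    ((q ++ [D]).take i).count D ≤ (q.take i).count D + 1 := by
  rw [List.take_append, List.count_append]
  gcongr
  exact (List.Sublist.count_le _ (List.take_sublist _ _)).trans (by simp [D])

lemma IsDyck.nest {q : List Step} (hq : IsDyck q) : IsDyck (U :: (q ++ [D])) := by
  refine ⟨by have := hq.1; simp_all [U, D, List.count_append], fun i => ?_⟩
  rcases i with _ | i
  · simp
  have h1 := hq.2 i
  have h2 := count_D_take_append_D_le q i
  have h3 : (q.take i).count U ≤ ((q ++ [D]).take i).count U := by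
    rw [List.take_append, List.count_append]; omega
  simp only [List.take_succ_cons, List.count_cons]
  simp only [U, D] at *
  simp
  omega

/-- A nested Dyck path touches the ground only at its ends. -/
lemma IsDyck.count_take_nest_lt {q : List Step} (hq : IsDyck q) {i : ℕ} (h0 : 0 < i)
    (hi : i ≤ q.length + 1) :
    ((U :: (q ++ [D])).take i).count D < ((U :: (q ++ [D])).take i).count U := by
  obtain ⟨i, rfl⟩ := Nat.exists_eq_succ_of_ne_zero h0.ne'
  have h1 := hq.2 i
  rw [Nat.succ_eq_add_one, List.take_succ_cons, List.take_append_of_le_length (by omega)]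
  simp only [List.count_cons]
  simp only [U, D] at *
  simp
  omega

/-- A Dyck path does not end with an upstep. -/
lemma not_isDyck_append_U (q : List Step) : ¬ IsDyck (q ++ [U]) := by
  rintro ⟨h1, h2⟩
  have h3 := h2 q.length
  simp [U, D, List.count_append] at h1 h3
  omega

lemma IsDyck.exists_eq_append_D {p : List Step} (hp : IsDyck p) (hne : p ≠ []) :
    ∃ q, p = q ++ [D] := by
  rcases List.eq_nil_or_concat p with rfl | ⟨q, b, rfl⟩
  · exact absurd rfl hne
  · cases b
    · exact ⟨q, by simp [D]⟩
    · exact absurd (by simpa [U] using hp) (not_isDyck_append_U q)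

lemma IsDyck.exists_eq_U_cons {p : List Step} (hp : IsDyck p) (hne : p ≠ []) :
    ∃ q, p = U :: q := by
  rcases p with _ | ⟨b, q⟩
  · exact absurd rfl hne
  · cases b
    · have := hp.2 1
      simp [U, D] at this
    · exact ⟨q, rfl⟩

/-- Decomposition of a nonempty Dyck path at its last return to the ground before the end. -/
lemma IsDyck.exists_last_return {p : List Step} (hp : IsDyck p) (hne : p ≠ []) :
    ∃ q r, p = q ++ U :: (r ++ [D]) ∧ IsDyck q ∧ IsDyck r := by
  have hlen : 0 < p.length := List.length_pos_iff.mpr hne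
  set P : ℕ → Prop := fun j => (p.take j).count U = (p.take j).count D with hP
  set j := Nat.findGreatest P (p.length - 1)
  have hj0 : P j := Nat.findGreatest_spec (P := P) (Nat.zero_le _) (by simp [hP])
  have hjl : j ≤ p.length - 1 := Nat.findGreatest_le _
  have hmax : ∀ k, j < k → k ≤ p.length - 1 → ¬ P k :=
    fun k h1 h2 => Nat.findGreatest_is_greatest h1 h2
  set q := p.take j with hq
  set s := p.drop j with hs
  have hps : p = q ++ s := (List.take_append_drop j p).symm
  have hql : q.length = j := by simp [hq]; omega
  have hsl : s.length = p.length - j := by simp [hs]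
  have hqd : IsDyck q := ⟨hj0, fun i => by rw [hq, List.take_take]; exact hp.2 _⟩
  have htake : ∀ k, p.take (j + k) = q ++ s.take k := fun k => List.take_add
  have hsle : ∀ k, (s.take k).count D ≤ (s.take k).count U := fun k => by
    have h1 := hp.2 (j + k)
    have h2 := hqd.1
    rw [htake, List.count_append, List.count_append] at h1
    omega
  have hseq : s.count U = s.count D := by
    have h1 := hp.1
    have h2 := hqd.1
    rw [hps, List.count_append, List.count_append] at h1
    omega
  have hslt : ∀ k, 0 < k → k < s.length → (s.take k).count D < (s.take k).count U :=
    fun k h0 h1 => by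
      refine lt_of_le_of_ne (hsle k) fun h => hmax (j + k) (by omega) (by omega) ?_
      have h2 := hqd.1
      simp only [hP]
      rw [htake, List.count_append, List.count_append]
      omega
  have hsd : IsDyck s := ⟨hseq, hsle⟩
  have hsne : s ≠ [] := List.ne_nil_of_length_pos (by omega)
  obtain ⟨t, ht⟩ := hsd.exists_eq_U_cons hsne
  rcases List.eq_nil_or_concat t with rfl | ⟨r, b, hr⟩
  · rw [ht] at hseq
    simp [U, D] at hseq
  obtain ⟨s', hs'⟩ := hsd.exists_eq_append_D hsne
  have hsr : s = U :: (r ++ [D]) := by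
    rw [ht, hr, List.concat_eq_append] at hs' ⊢
    rw [← List.cons_append] at hs'
    rw [(List.append_inj' hs' rfl).2]
  refine ⟨q, r, hsr ▸ hps, hqd, ?_, fun i => ?_⟩
  · rw [hsr] at hseq
    simp only [List.count_cons, List.count_append] at hseq
    simpa [U, D] using hseq
  · have h1 := hslt (min i r.length + 1) (by omega) (by rw [hsr]; simp)
    rw [hsr, List.take_succ_cons, List.take_append_of_le_length (by omega)] at h1
    simp only [List.count_cons] at h1
    have h2 : r.take (min i r.length) = r.take i := by
      rw [← List.take_take, List.take_length]
    rw [h2] at h1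
    simp only [U, D] at *
    simp at h1
    omega

/-- The Dyck paths of size `n` counted in the theorem. -/
def goodPaths (n : ℕ) : Set (List Step) :=
  {p | IsDyck p ∧ p.count U = n ∧ EndsDD p ∧ GroundDUU p}

lemma endsDD_groundDUU_of_ne_nil {q r : List Step} (hq : IsDyck q) (hr : IsDyck r)
    (hq0 : q ≠ []) (hr0 : r ≠ []) :
    EndsDD (q ++ U :: (r ++ [D])) ∧ GroundDUU (q ++ U :: (r ++ [D])) := by
  obtain ⟨r', hr'⟩ := hr.exists_eq_append_D hr0
  obtain ⟨r'', hr''⟩ := hr.exists_eq_U_cons hr0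
  obtain ⟨q', hq'⟩ := hq.exists_eq_append_D hq0
  refine ⟨⟨q ++ U :: r', by simp [hr']⟩, q'.length, ?_, ?_⟩
  · simp [hq', hr'']
  · have h : q'.length + 1 = q.length := by simp [hq']
    rw [h, List.take_left]
    exact hq.1

lemma not_groundDUU_nest {r : List Step} (hr : IsDyck r) : ¬ GroundDUU (U :: (r ++ [D])) := by
  rintro ⟨j, h1, h2⟩
  have h3 := congrArg List.length h1
  simp only [List.length_take, List.length_drop, List.length_cons, List.length_append,
    List.length_nil] at h3
  exact (hr.count_take_nest_lt (i := j + 1) (by omega) (by omega)).ne' h2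

lemma not_endsDD_append_UD (q : List Step) : ¬ EndsDD (q ++ [U, D]) := by
  rintro ⟨q', h⟩
  have := (List.append_inj' h rfl).2
  simp [U, D] at this

lemma dyckPaths_succ_eq (m : ℕ) :
    dyckPaths (m + 1) = goodPaths (m + 1) ∪
      ((fun r => U :: (r ++ [D])) '' dyckPaths m ∪ (fun q => q ++ [U, D]) '' dyckPaths m) := by
  ext p
  constructor
  · rintro ⟨hp, hc⟩
    have hne : p ≠ [] := by rintro rfl; simp at hc
    obtain ⟨q, r, rfl, hq, hr⟩ := hp.exists_last_return hne
    by_cases hq0 : q = []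
    · subst hq0
      exact Or.inr (Or.inl ⟨r, ⟨hr, by simpa [U, D] using hc⟩, rfl⟩)
    by_cases hr0 : r = []
    · subst hr0
      exact Or.inr (Or.inr ⟨q, ⟨hq, by simpa [U, D] using hc⟩, rfl⟩)
    exact Or.inl ⟨hp, hc, endsDD_groundDUU_of_ne_nil hq hr hq0 hr0⟩
  · rintro (⟨hp, hc, -⟩ | ⟨r, ⟨hr, hc⟩, rfl⟩ | ⟨q, ⟨hq, hc⟩, rfl⟩)
    · exact ⟨hp, hc⟩
    · exact ⟨hr.nest, by simpa [U, D] using hc⟩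
    · exact ⟨hq.append isDyck_UD, by simpa [U, D] using hc⟩

lemma ncard_goodPaths_add (m : ℕ) (hm : 0 < m) :
    (goodPaths (m + 1)).ncard + 2 * catalan m = catalan (m + 1) := by
  have hfin := finite_dyckPaths (m + 1)
  have hfin' := finite_dyckPaths m
  have hdisj : Disjoint ((fun r => U :: (r ++ [D])) '' dyckPaths m)
      ((fun q => q ++ [U, D]) '' dyckPaths m) := by
    rw [Set.disjoint_left]
    rintro _ ⟨r, ⟨hr, -⟩, rfl⟩ ⟨q, ⟨hq, hc⟩, h⟩
    obtain ⟨q', rfl⟩ := hq.exists_eq_U_cons (by rintro rfl; simp at hc; omega)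
    have h' : q' ++ [U] = r := by
      have : (q' ++ [U]) ++ [D] = r ++ [D] := by simpa using h
      exact List.append_cancel_right this
    exact not_isDyck_append_U q' (h' ▸ hr)
  have hdisj' : Disjoint (goodPaths (m + 1)) ((fun r => U :: (r ++ [D])) '' dyckPaths m ∪
      (fun q => q ++ [U, D]) '' dyckPaths m) := by
    rw [Set.disjoint_left]
    rintro _ ⟨-, -, hE, hG⟩ (⟨r, ⟨hr, -⟩, rfl⟩ | ⟨q, -, rfl⟩)
    · exact not_groundDUU_nest hr hG
    · exact not_endsDD_append_UD q hE
  have hgood : (goodPaths (m + 1)).Finite := hfin.subset fun p hp => ⟨hp.1, hp.2.1⟩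
  rw [← ncard_dyckPaths (m + 1), dyckPaths_succ_eq,
    Set.ncard_union_eq hdisj' hgood ((hfin'.image _).union (hfin'.image _)),
    Set.ncard_union_eq hdisj (hfin'.image _) (hfin'.image _),
    Set.ncard_image_of_injective _ (fun a b h => by simpa using h),
    Set.ncard_image_of_injective _ (fun a b h => by simpa using h), ncard_dyckPaths]
  ring

lemma succ_succ_mul_catalan_succ (m : ℕ) :
    (m + 2) * catalan (m + 1) = 2 * (2 * m + 1) * catalan m := by
  have h1 := succ_mul_catalan_eq_centralBinom m
  have h2 := succ_mul_catalan_eq_centralBinom (m + 1)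
  have h3 := Nat.succ_mul_centralBinom_succ m
  apply Nat.eq_of_mul_eq_mul_left (Nat.succ_pos m)
  rw [← h1, ← h2] at h3
  linarith

lemma add_four_mul_choose_eq (k : ℕ) :
    (k + 4) * Nat.choose (2 * k + 4) k = (k + 2) * (k + 1) * catalan (k + 2) := by
  have h1 := succ_mul_catalan_eq_centralBinom (k + 2)
  rw [Nat.centralBinom_eq_two_mul_choose] at h1
  have h2 := Nat.choose_succ_right_eq (2 * k + 4) k
  have h3 := Nat.choose_succ_right_eq (2 * k + 4) (k + 1)
  rw [show 2 * k + 4 - k = k + 4 by omega] at h2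
  rw [show 2 * k + 4 - (k + 1) = k + 3 by omega] at h3
  rw [show 2 * (k + 2) = 2 * k + 4 by ring] at h1
  rw [show k + 1 + 1 = k + 2 by ring, ← h1] at h3
  have h4 : (k + 2) * catalan (k + 2) = Nat.choose (2 * k + 4) (k + 1) := by
    apply Nat.eq_of_mul_eq_mul_left (Nat.succ_pos (k + 2))
    linarith
  rw [← h4] at h2
  linarith

/-- For `n ≥ 3`, if `N` is the number of Dyck `n`-paths that
end `DD` and contain a ground-level `DUU`, then
`(n - 1) * N = 2 * C(2n - 2, n - 3)`. -/
theorem stmt_18 (n : ℕ) (hn : 3 ≤ n) :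
    (n - 1) *
        Nat.card {p : List Step //
          IsDyck p ∧ p.count U = n ∧ EndsDD p ∧ GroundDUU p} =
      2 * Nat.choose (2 * n - 2) (n - 3) := by
  obtain ⟨k, rfl⟩ := Nat.exists_eq_add_of_le hn
  have h1 := ncard_goodPaths_add (k + 2) (by omega)
  have h2 := succ_succ_mul_catalan_succ (k + 2)
  have h3 := add_four_mul_choose_eq k
  have h4 : Nat.card {p : List Step //
      IsDyck p ∧ p.count U = 3 + k ∧ EndsDD p ∧ GroundDUU p} = (goodPaths (k + 2 + 1)).ncard := by
    rw [← Nat.card_coe_set_eq, show k + 2 + 1 = 3 + k by ring]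
    rfl
  rw [h4, show 3 + k - 1 = k + 2 by omega, show 2 * (3 + k) - 2 = 2 * k + 4 by omega,
    show 3 + k - 3 = k by omega]
  apply Nat.eq_of_mul_eq_mul_left (show 0 < k + 4 by omega)
  rw [← h1] at h2
  have h5 : (k + 4) * (goodPaths (k + 2 + 1)).ncard = 2 * (k + 1) * catalan (k + 2) := by
    linarith
  calc (k + 4) * ((k + 2) * (goodPaths (k + 2 + 1)).ncard)
      = (k + 2) * ((k + 4) * (goodPaths (k + 2 + 1)).ncard) := by ring
    _ = 2 * ((k + 2) * (k + 1) * catalan (k + 2)) := by rw [h5]; ring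
    _ = _ := by rw [← h3]; ring

end Paper
end
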